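/- arXiv:2206.02635 — 5 statements merged into one kernel-verified Lean document; each statement's English description precedes it below -/
import Mathlib

section
/- Let $T \in \mathbb{R}$, $t_0 < T$, and $C > 0$. Suppose $u : (t_0, T) \to \mathbb{R}$ is differentiable, satisfies $u'(t) \ge 2\,u(t)\,(u(t) - C)$ and $u(t) > C$ for all $t \in (t_0, T)$, and $u(t) \to +\infty$ as $t \to T^-$. Then for every $t \in (t_0, T)$ one has $u(t) \le \dfrac{C\, e^{2C(T-t)}}{e^{2C(T-t)} - 1}$. -/
open Real Set

/-- If `u' ≥ 2 u (u - C)` and `u > C > 0`, then `(1 - C / u) e^{-2Ct}` is nondecreasing. -/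
theorem monotoneOn_one_sub_div_mul_exp {T t0 C : ℝ} (hC : 0 < C) {u u' : ℝ → ℝ}
    (hderiv : ∀ t ∈ Ioo t0 T, HasDerivAt u (u' t) t)
    (hineq : ∀ t ∈ Ioo t0 T, 2 * u t * (u t - C) ≤ u' t)
    (hgt : ∀ t ∈ Ioo t0 T, C < u t) :
    MonotoneOn (fun t => (1 - C / u t) * Real.exp (-(2 * C * t))) (Ioo t0 T) := by
  have hd : ∀ t ∈ Ioo t0 T, HasDerivAt (fun t => (1 - C / u t) * Real.exp (-(2 * C * t)))
      (C * (u' t - 2 * u t * (u t - C)) / u t ^ 2 * Real.exp (-(2 * C * t))) t := by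
    intro t ht
    have hu : u t ≠ 0 := (hC.trans (hgt t ht)).ne'
    have hquot := (((hasDerivAt_const t C).div (hderiv t ht) hu).const_sub 1)
    have hexp := (((hasDerivAt_id t).const_mul (2 * C)).neg).exp
    refine (hquot.mul hexp).congr_deriv ?_
    simp only [Pi.div_apply, Pi.neg_apply, id]
    field_simp
    ring
  refine monotoneOn_of_hasDerivWithinAt_nonneg (convex_Ioo t0 T)
    (fun t ht => (hd t ht).continuousAt.continuousWithinAt)
    (fun t ht => (hd t (interior_subset ht)).hasDerivWithinAt) fun t ht => ?_
  have := sub_nonneg.2 (hineq t (interior_subset ht))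
  positivity

theorem mcf_blowup_bound (T t0 C : ℝ) (ht0 : t0 < T) (hC : 0 < C)
    (u u' : ℝ → ℝ)
    (hderiv : ∀ t ∈ Ioo t0 T, HasDerivAt u (u' t) t)
    (hineq : ∀ t ∈ Ioo t0 T, 2 * u t * (u t - C) ≤ u' t)
    (hgt : ∀ t ∈ Ioo t0 T, C < u t)
    (hblow : Filter.Tendsto u (nhdsWithin T (Iio T)) Filter.atTop) :
    ∀ t ∈ Ioo t0 T,
      u t ≤ C * Real.exp (2 * C * (T - t)) / (Real.exp (2 * C * (T - t)) - 1) := by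
  intro t ht
  have hu : 0 < u t := hC.trans (hgt t ht)
  have hmono := monotoneOn_one_sub_div_mul_exp hC hderiv hineq hgt
  have hlim : Filter.Tendsto (fun s => (1 - C / u s) * Real.exp (-(2 * C * s)))
      (nhdsWithin T (Iio T)) (nhds ((1 - 0) * Real.exp (-(2 * C * T)))) := by
    refine (tendsto_const_nhds.sub (hblow.const_div_atTop C)).mul ?_
    have hcont : Continuous fun s : ℝ => Real.exp (-(2 * C * s)) := by fun_prop
    exact hcont.continuousAt.tendsto.mono_left nhdsWithin_le_nhds
  have hle : (1 - C / u t) * Real.exp (-(2 * C * t)) ≤ (1 - 0) * Real.exp (-(2 * C * T)) := by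
    refine ge_of_tendsto hlim ?_
    filter_upwards [Ioo_mem_nhdsLT ht.2] with s hs
    exact hmono ht ⟨ht.1.trans hs.1, hs.2⟩ hs.1.le
  have hE : 1 < Real.exp (2 * C * (T - t)) :=
    Real.one_lt_exp_iff.2 (mul_pos (by positivity) (sub_pos.2 ht.2))
  have hbound : (1 - C / u t) * Real.exp (2 * C * (T - t)) ≤ 1 := by
    have h := mul_le_mul_of_nonneg_right hle (Real.exp_pos (2 * C * T)).le
    rw [mul_assoc (1 - C / u t), mul_assoc (1 - 0 : ℝ), ← Real.exp_add, ← Real.exp_add] at h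
    have hsplit : -(2 * C * t) + 2 * C * T = 2 * C * (T - t) := by ring
    simpa only [hsplit, neg_add_cancel, Real.exp_zero, sub_zero, mul_one] using h
  rw [le_div_iff₀ (sub_pos.2 hE)]
  have h := mul_le_mul_of_nonneg_left hbound hu.le
  have hcancel : u t * (C / u t) = C := mul_div_cancel₀ C hu.ne'
  linear_combination h + Real.exp (2 * C * (T - t)) * hcancel
end

section
/- Let $T \in \mathbb{R}$, $t_0 < T$, and $C > 0$. Suppose $u : (t_0, T) \to \mathbb{R}$ is differentiable, satisfies $u'(t) \ge 2\,u(t)\,(u(t) - C)$ and $u(t) > C$ for all $t \in (t_0, T)$, and $u(t) \to +\infty$ as $t \to T^-$. Then $\limsup_{t \to T^-} (T - t)\, u(t) \le \tfrac{1}{2} < \infty$; in particular the blow-up of $u$ at $T$ satisfies the Type I condition. -/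
open Filter Topology in
/-- A solution of `2 u (u - C) ≤ u'` with `u > C` that blows up at `T` satisfies
`u t ≤ C / (1 - exp (-2 C (T - t)))`, stated here as a bound on `1 - C / u t`. -/
theorem one_sub_div_le_exp_of_blowup {T t0 C : ℝ} (hC : 0 < C) {u u' : ℝ → ℝ}
    (hderiv : ∀ t ∈ Set.Ioo t0 T, HasDerivAt u (u' t) t)
    (hineq : ∀ t ∈ Set.Ioo t0 T, 2 * u t * (u t - C) ≤ u' t)
    (hgt : ∀ t ∈ Set.Ioo t0 T, C < u t)
    (hblow : Tendsto u (𝓝[<] T) atTop) {t : ℝ} (ht : t ∈ Set.Ioo t0 T) :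
    1 - C / u t ≤ Real.exp (-(2 * C * (T - t))) := by
  set g : ℝ → ℝ := fun s => (1 - C / u s) * Real.exp (2 * C * (T - s)) with hg
  have hg' : ∀ s ∈ Set.Ioo t0 T, HasDerivAt g
      ((C * u' s / u s ^ 2 - 2 * C * (1 - C / u s)) * Real.exp (2 * C * (T - s))) s := by
    intro s hs
    have hu : u s ≠ 0 := (hC.trans (hgt s hs)).ne'
    have h1 := ((hasDerivAt_const s C).div (hderiv s hs) hu).const_sub 1
    have h2 := (((hasDerivAt_id s).const_sub T).const_mul (2 * C)).exp
    refine (h1.mul h2).congr_deriv ?_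
    simp only [id, Pi.div_apply]
    field_simp
    ring
  have hmono : MonotoneOn g (Set.Ioo t0 T) := by
    refine monotoneOn_of_deriv_nonneg (convex_Ioo t0 T)
      (fun s hs => (hg' s hs).continuousAt.continuousWithinAt)
      (fun s hs => (hg' s (interior_subset hs)).differentiableAt.differentiableWithinAt) ?_
    intro s hs
    replace hs := interior_subset hs
    rw [(hg' s hs).deriv]
    refine mul_nonneg ?_ (Real.exp_pos _).le
    have hu : 0 < u s := hC.trans (hgt s hs)
    have key : C * u' s / u s ^ 2 - 2 * C * (1 - C / u s)
        = C * (u' s - 2 * u s * (u s - C)) / u s ^ 2 := by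
      field_simp
    rw [key]
    have := sub_nonneg.2 (hineq s hs)
    positivity
  have hlim : Tendsto g (𝓝[<] T) (𝓝 1) := by
    have h1 : Tendsto (fun s => 1 - C / u s) (𝓝[<] T) (𝓝 (1 - 0)) :=
      (hblow.const_div_atTop C).const_sub 1
    have h2 : Tendsto (fun s => Real.exp (2 * C * (T - s))) (𝓝[<] T)
        (𝓝 (Real.exp (2 * C * (T - T)))) :=
      (Continuous.tendsto (by fun_prop) T).mono_left nhdsWithin_le_nhds
    simpa using h1.mul h2
  have hle : g t ≤ 1 := by
    refine ge_of_tendsto hlim ?_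
    filter_upwards [Ioo_mem_nhdsLT ht.2] with s hs
    exact hmono ht ⟨ht.1.trans hs.1, hs.2⟩ hs.1.le
  rw [Real.exp_neg, ← one_div, le_div_iff₀ (Real.exp_pos _)]
  exact hle

open Filter Topology in
theorem sub_mul_le_of_blowup {T t0 C : ℝ} (hC : 0 < C) {u u' : ℝ → ℝ}
    (hderiv : ∀ t ∈ Set.Ioo t0 T, HasDerivAt u (u' t) t)
    (hineq : ∀ t ∈ Set.Ioo t0 T, 2 * u t * (u t - C) ≤ u' t)
    (hgt : ∀ t ∈ Set.Ioo t0 T, C < u t)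
    (hblow : Tendsto u (𝓝[<] T) atTop) {t : ℝ} (ht : t ∈ Set.Ioo t0 T) :
    (T - t) * u t ≤ 1 / 2 + C * (T - t) := by
  have hu : 0 < u t := hC.trans (hgt t ht)
  have hs : 0 < C * (T - t) := mul_pos hC (sub_pos.2 ht.2)
  have hexp : Real.exp (-(2 * C * (T - t))) ≤ 1 / (1 + 2 * C * (T - t)) := by
    rw [Real.exp_neg, ← one_div]
    exact one_div_le_one_div_of_le (by linarith)
      (by linarith [Real.add_one_le_exp (2 * C * (T - t))])
  have h := (one_sub_div_le_exp_of_blowup hC hderiv hineq hgt hblow ht).trans hexp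
  rw [one_sub_div hu.ne', div_le_div_iff₀ hu (by linarith)] at h
  refine le_of_mul_le_mul_left ?_ (mul_pos two_pos hC)
  linarith

open Real Set

theorem mcf_type_one_singularity (T t0 C : ℝ) (ht0 : t0 < T) (hC : 0 < C)
    (u u' : ℝ → ℝ)
    (hderiv : ∀ t ∈ Ioo t0 T, HasDerivAt u (u' t) t)
    (hineq : ∀ t ∈ Ioo t0 T, 2 * u t * (u t - C) ≤ u' t)
    (hgt : ∀ t ∈ Ioo t0 T, C < u t)
    (hblow : Filter.Tendsto u (nhdsWithin T (Iio T)) Filter.atTop) :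
    Filter.limsup (fun t => (T - t) * u t) (nhdsWithin T (Iio T)) ≤ 1 / 2 := by
  have hlim : Filter.Tendsto (fun t => 1 / 2 + C * (T - t)) (nhdsWithin T (Iio T))
      (nhds (1 / 2)) := by
    have h : Filter.Tendsto (fun t => 1 / 2 + C * (T - t)) (nhds T)
        (nhds (1 / 2 + C * (T - T))) := Continuous.tendsto (by fun_prop) T
    simpa using h.mono_left nhdsWithin_le_nhds
  rw [← hlim.limsup_eq]
  have hmem := Ioo_mem_nhdsLT ht0
  refine Filter.limsup_le_limsup ?_ ?_ hlim.isBoundedUnder_le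
  · filter_upwards [hmem] with t ht
    exact sub_mul_le_of_blowup hC hderiv hineq hgt hblow ht
  · refine Filter.IsBoundedUnder.isCoboundedUnder_le ⟨0, Filter.eventually_map.2 ?_⟩
    filter_upwards [hmem] with t ht
    exact mul_nonneg (sub_pos.2 ht.2).le (hC.trans (hgt t ht)).le
end

section
/- Let $p, q \in \mathbb{R}^3$ with $\|p\| = \|q\| = 1$ and $\langle p, q \rangle = t$ where $-1 < t < 1$, and let $r \in \mathbb{R}$. Define $\mathcal{P}_r = \cos\!\big(\tfrac{r}{\sqrt{2}}\big) p + \sin\!\big(\tfrac{r}{\sqrt{2}}\big) \dfrac{q - t p}{\sqrt{1 - t^2}}$ and $\mathcal{Q}_r = \cos\!\big(\tfrac{r}{\sqrt{2}}\big) q + \sin\!\big(\tfrac{r}{\sqrt{2}}\big) \dfrac{p - t q}{\sqrt{1 - t^2}}$. Then $\|\mathcal{P}_r\| = \|\mathcal{Q}_r\| = 1$ and $\langle \mathcal{P}_r, \mathcal{Q}_r \rangle = t \cos(\sqrt{2}\, r) + \sqrt{1 - t^2}\, \sin(\sqrt{2}\, r)$. -/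
open scoped RealInnerProductSpace

section
variable {E : Type*} [NormedAddCommGroup E] [InnerProductSpace ℝ E]

/-- Rotating a unit vector `p` within the plane spanned by `p` and `q` keeps it a unit vector. -/
lemma norm_cos_smul_add_sin_smul_eq_one {p q : E} {t w : ℝ} (hp : ‖p‖ = 1) (hq : ‖q‖ = 1)
    (hpq : ⟪p, q⟫ = t) (hw : w ≠ 0) (hwt : w ^ 2 = 1 - t ^ 2) (θ : ℝ) :
    ‖Real.cos θ • p + Real.sin θ • (w⁻¹ • (q - t • p))‖ = 1 := by
  have hqp : ⟪q, p⟫ = t := by rw [real_inner_comm, hpq]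
  have hpp : ⟪p, p⟫ = 1 := by rw [real_inner_self_eq_norm_sq, hp, one_pow]
  have hqq : ⟪q, q⟫ = 1 := by rw [real_inner_self_eq_norm_sq, hq, one_pow]
  rw [← sq_eq_sq₀ (norm_nonneg _) zero_le_one, ← real_inner_self_eq_norm_sq]
  simp only [inner_add_left, inner_add_right, inner_sub_left, inner_sub_right,
    real_inner_smul_left, real_inner_smul_right, hpp, hqq, hpq, hqp]
  field_simp
  linear_combination w ^ 2 * Real.sin_sq_add_cos_sq θ - Real.sin θ ^ 2 * hwt

/-- Rotating two unit vectors `p` and `q` towards each other by the angle `θ` changes the angle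
between them by `2 * θ`. -/
lemma inner_cos_smul_add_sin_smul {p q : E} {t w : ℝ} (hp : ‖p‖ = 1) (hq : ‖q‖ = 1)
    (hpq : ⟪p, q⟫ = t) (hw : w ≠ 0) (hwt : w ^ 2 = 1 - t ^ 2) (θ : ℝ) :
    ⟪Real.cos θ • p + Real.sin θ • (w⁻¹ • (q - t • p)),
      Real.cos θ • q + Real.sin θ • (w⁻¹ • (p - t • q))⟫ =
      t * Real.cos (2 * θ) + w * Real.sin (2 * θ) := by
  have hqp : ⟪q, p⟫ = t := by rw [real_inner_comm, hpq]
  have hpp : ⟪p, p⟫ = 1 := by rw [real_inner_self_eq_norm_sq, hp, one_pow]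
  have hqq : ⟪q, q⟫ = 1 := by rw [real_inner_self_eq_norm_sq, hq, one_pow]
  rw [Real.cos_two_mul', Real.sin_two_mul]
  simp only [inner_add_left, inner_add_right, inner_sub_left, inner_sub_right,
    real_inner_smul_left, real_inner_smul_right, hpp, hqq, hpq, hqp]
  field_simp
  linear_combination (t * Real.sin θ ^ 2 - 2 * w * Real.sin θ * Real.cos θ) * hwt

end

theorem s2_times_s2_parallel_displacement (t r : ℝ) (ht : -1 < t) (ht' : t < 1)
    (p q : EuclideanSpace ℝ (Fin 3)) (hp : ‖p‖ = 1) (hq : ‖q‖ = 1) (hpq : ⟪p, q⟫ = t) :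
    let P : EuclideanSpace ℝ (Fin 3) :=
      Real.cos (r / Real.sqrt 2) • p +
        Real.sin (r / Real.sqrt 2) • ((Real.sqrt (1 - t ^ 2))⁻¹ • (q - t • p))
    let Q : EuclideanSpace ℝ (Fin 3) :=
      Real.cos (r / Real.sqrt 2) • q +
        Real.sin (r / Real.sqrt 2) • ((Real.sqrt (1 - t ^ 2))⁻¹ • (p - t • q))
    ‖P‖ = 1 ∧ ‖Q‖ = 1 ∧
      ⟪P, Q⟫ = t * Real.cos (Real.sqrt 2 * r) + Real.sqrt (1 - t ^ 2) * Real.sin (Real.sqrt 2 * r) := by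
  have hpos : 0 < 1 - t ^ 2 := by nlinarith
  have hw : Real.sqrt (1 - t ^ 2) ≠ 0 := (Real.sqrt_pos.2 hpos).ne'
  have hwt : Real.sqrt (1 - t ^ 2) ^ 2 = 1 - t ^ 2 := Real.sq_sqrt hpos.le
  have hqp : ⟪q, p⟫ = t := by rw [real_inner_comm, hpq]
  have hangle : Real.sqrt 2 * r = 2 * (r / Real.sqrt 2) := by
    field_simp
    rw [Real.sq_sqrt zero_le_two]
    ring
  refine ⟨norm_cos_smul_add_sin_smul_eq_one hp hq hpq hw hwt _,
    norm_cos_smul_add_sin_smul_eq_one hq hp hqp hw hwt _, ?_⟩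
  rw [hangle]
  exact inner_cos_smul_add_sin_smul hp hq hpq hw hwt _
end

section
/- Let $t > 1$ and let $p, q, w \in \mathbb{R}^3$ satisfy $\langle p, p \rangle_L = \langle q, q \rangle_L = -1$, $\langle p, q \rangle_L = -t$, and $\langle w, p \rangle_L = \langle w, q \rangle_L = 0$. Define $A : \mathbb{R}^3 \times \mathbb{R}^3 \to \mathbb{R}^3 \times \mathbb{R}^3$ by $A(v_1, v_2) = \dfrac{1}{\sqrt{2(t^2-1)}}\big(t v_1 - v_2 + \langle v_1, q \rangle_L\, p,\;\; t v_2 - v_1 + \langle v_2, p \rangle_L\, q\big)$. Then $A(w, -w) = \dfrac{1}{\sqrt{2}}\sqrt{\dfrac{t+1}{t-1}}\,(w, -w)$, $A(w, w) = \dfrac{1}{\sqrt{2}}\sqrt{\dfrac{t-1}{t+1}}\,(w, w)$, and $A(q - tp,\; -p + tq) = (0, 0)$. -/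
/-- The Lorentzian bilinear form of `𝕃³`. -/
def lorentz (x y : Fin 3 → ℝ) : ℝ := x 0 * y 0 + x 1 * y 1 - x 2 * y 2

/-- For `a ≥ 0`, `a / √(2ab) = √(a / b) / √2`. -/
theorem inv_sqrt_two_mul_mul_self {a : ℝ} (ha : 0 ≤ a) (b : ℝ) :
    (Real.sqrt (2 * (a * b)))⁻¹ * a = (Real.sqrt 2)⁻¹ * Real.sqrt (a / b) := by
  rw [Real.sqrt_mul zero_le_two, Real.sqrt_mul ha, Real.sqrt_div ha, mul_inv, mul_inv, mul_assoc,
    mul_right_comm, inv_mul_eq_div (Real.sqrt a), Real.div_sqrt, div_eq_mul_inv]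

theorem h2_times_h2_shape_operator (t : ℝ) (ht : 1 < t) (p q w : Fin 3 → ℝ)
    (hp : lorentz p p = -1) (hq : lorentz q q = -1) (hpq : lorentz p q = -t)
    (hwp : lorentz w p = 0) (hwq : lorentz w q = 0) :
    let A : (Fin 3 → ℝ) × (Fin 3 → ℝ) → (Fin 3 → ℝ) × (Fin 3 → ℝ) := fun v =>
      (Real.sqrt (2 * (t ^ 2 - 1)))⁻¹ •
        (t • v.1 - v.2 + lorentz v.1 q • p, t • v.2 - v.1 + lorentz v.2 p • q)
    A (w, -w) = ((Real.sqrt 2)⁻¹ * Real.sqrt ((t + 1) / (t - 1))) • ((w, -w) : (Fin 3 → ℝ) × (Fin 3 → ℝ)) ∧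
    A (w, w) = ((Real.sqrt 2)⁻¹ * Real.sqrt ((t - 1) / (t + 1))) • ((w, w) : (Fin 3 → ℝ) × (Fin 3 → ℝ)) ∧
    A (q - t • p, -p + t • q) = (0, 0) := by
  intro A
  have lorentz_neg_left : ∀ x y, lorentz (-x) y = -lorentz x y := fun x y => by
    simp only [lorentz, Pi.neg_apply]; ring
  have h_plus := inv_sqrt_two_mul_mul_self (a := t + 1) (by linarith) (t - 1)
  have h_minus := inv_sqrt_two_mul_mul_self (a := t - 1) (by linarith) (t + 1)
  rw [show (t + 1) * (t - 1) = t ^ 2 - 1 by ring] at h_plus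
  rw [show (t - 1) * (t + 1) = t ^ 2 - 1 by ring] at h_minus
  refine ⟨?_, ?_, ?_⟩
  · rw [← h_plus, mul_smul]
    simp only [A, lorentz_neg_left, hwp, hwq, Prod.smul_mk]
    congr 2 <;> module
  · rw [← h_minus, mul_smul]
    simp only [A, hwp, hwq, Prod.smul_mk]
    congr 2 <;> module
  · have h_left : lorentz (q - t • p) q = t ^ 2 - 1 := by
      simp only [lorentz, Pi.sub_apply, Pi.smul_apply, smul_eq_mul] at *
      linear_combination hq - t * hpq
    have h_right : lorentz (-p + t • q) p = 1 - t ^ 2 := by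
      simp only [lorentz, Pi.add_apply, Pi.neg_apply, Pi.smul_apply, smul_eq_mul] at *
      linear_combination -hp + t * hpq
    simp only [A, h_left, h_right, Prod.smul_mk]
    congr 1 <;> module
end

section
/- Let $t > 1$, let $p, q \in \mathbb{R}^3$ satisfy $\langle p, p \rangle_L = \langle q, q \rangle_L = -1$ and $\langle p, q \rangle_L = -t$, and let $r \in \mathbb{R}$. Define $\mathcal{P}_r = \cosh\!\big(\tfrac{r}{\sqrt{2}}\big) p + \sinh\!\big(\tfrac{r}{\sqrt{2}}\big) \dfrac{q - t p}{\sqrt{t^2 - 1}}$ and $\mathcal{Q}_r = \cosh\!\big(\tfrac{r}{\sqrt{2}}\big) q + \sinh\!\big(\tfrac{r}{\sqrt{2}}\big) \dfrac{p - t q}{\sqrt{t^2 - 1}}$. Then $\langle \mathcal{P}_r, \mathcal{P}_r \rangle_L = \langle \mathcal{Q}_r, \mathcal{Q}_r \rangle_L = -1$ and $\langle \mathcal{P}_r, \mathcal{Q}_r \rangle_L = -t \cosh(\sqrt{2}\, r) + \sqrt{t^2 - 1}\, \sinh(\sqrt{2}\, r)$. -/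
theorem lorentz_comm (x y : Fin 3 → ℝ) : lorentz x y = lorentz y x := by
  simp only [lorentz]
  ring

/-- The Lorentzian form on two combinations of the shape `c • x + d • (a • (y - t • x))`. -/
theorem lorentz_combination (c d a t : ℝ) (x y z w : Fin 3 → ℝ) :
    lorentz (c • x + d • (a • (y - t • x))) (c • z + d • (a • (w - t • z))) =
      c ^ 2 * lorentz x z
        + c * d * a * (lorentz x w + lorentz y z - 2 * t * lorentz x z)
        + d ^ 2 * a ^ 2 * (lorentz y w - t * lorentz x w - t * lorentz y z
          + t ^ 2 * lorentz x z) := by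
  simp only [lorentz, Pi.add_apply, Pi.sub_apply, Pi.smul_apply, smul_eq_mul]
  ring

/-- The geodesic of `ℍ²` issuing from `p` towards `q` stays in the unit hyperboloid. -/
theorem lorentz_geodesic_self {c d s t : ℝ} {p q : Fin 3 → ℝ} (hs : s ≠ 0)
    (hs2 : s ^ 2 = t ^ 2 - 1) (hp : lorentz p p = -1) (hq : lorentz q q = -1)
    (hpq : lorentz p q = -t) (hcd : c ^ 2 - d ^ 2 = 1) :
    lorentz (c • p + d • (s⁻¹ • (q - t • p))) (c • p + d • (s⁻¹ • (q - t • p))) = -1 := by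
  have hinv : s⁻¹ ^ 2 * (t ^ 2 - 1) = 1 := by rw [← hs2]; field_simp
  rw [lorentz_combination, lorentz_comm q p, hp, hq, hpq]
  linear_combination d ^ 2 * hinv - hcd

/-- The Lorentzian product of the geodesic from `p` towards `q` with the one from `q`
towards `p`. -/
theorem lorentz_geodesic_geodesic {s t : ℝ} (c d : ℝ) {p q : Fin 3 → ℝ} (hs : s ≠ 0)
    (hs2 : s ^ 2 = t ^ 2 - 1) (hp : lorentz p p = -1) (hq : lorentz q q = -1)
    (hpq : lorentz p q = -t) :
    lorentz (c • p + d • (s⁻¹ • (q - t • p))) (c • q + d • (s⁻¹ • (p - t • q))) =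
      -t * (c ^ 2 + d ^ 2) + 2 * c * d * s := by
  have hinv : s⁻¹ ^ 2 * (t ^ 2 - 1) = 1 := by rw [← hs2]; field_simp
  have hinv' : s⁻¹ * (t ^ 2 - 1) = s := by rw [← hs2]; field_simp
  rw [lorentz_combination, lorentz_comm q p, hp, hq, hpq]
  linear_combination -t * d ^ 2 * hinv + 2 * c * d * hinv'

theorem h2_times_h2_parallel_displacement (t r : ℝ) (ht : 1 < t) (p q : Fin 3 → ℝ)
    (hp : lorentz p p = -1) (hq : lorentz q q = -1) (hpq : lorentz p q = -t) :
    let P : Fin 3 → ℝ :=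
      Real.cosh (r / Real.sqrt 2) • p +
        Real.sinh (r / Real.sqrt 2) • ((Real.sqrt (t ^ 2 - 1))⁻¹ • (q - t • p))
    let Q : Fin 3 → ℝ :=
      Real.cosh (r / Real.sqrt 2) • q +
        Real.sinh (r / Real.sqrt 2) • ((Real.sqrt (t ^ 2 - 1))⁻¹ • (p - t • q))
    lorentz P P = -1 ∧ lorentz Q Q = -1 ∧
      lorentz P Q = -t * Real.cosh (Real.sqrt 2 * r) +
        Real.sqrt (t ^ 2 - 1) * Real.sinh (Real.sqrt 2 * r) := by
  intro P Q
  have hs : 0 < √(t ^ 2 - 1) := Real.sqrt_pos.mpr (by nlinarith)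
  have hs2 : √(t ^ 2 - 1) ^ 2 = t ^ 2 - 1 := Real.sq_sqrt (by nlinarith)
  have hr : √2 * r = 2 * (r / √2) := by
    field_simp
    rw [Real.sq_sqrt zero_le_two]
    ring
  have hqp : lorentz q p = -t := by rw [← hpq, lorentz_comm]
  rw [hr, Real.cosh_two_mul, Real.sinh_two_mul]
  refine ⟨lorentz_geodesic_self hs.ne' hs2 hp hq hpq (Real.cosh_sq_sub_sinh_sq _),
    lorentz_geodesic_self hs.ne' hs2 hq hp hqp (Real.cosh_sq_sub_sinh_sq _), ?_⟩
  rw [lorentz_geodesic_geodesic _ _ hs.ne' hs2 hp hq hpq]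
  ring
end
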